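/- Let x, y ∈ M_n(ℂ) be positive semidefinite, let z ∈ M_n(ℂ), and let t ∈ [1/2, 1]. Set B_t = x^t z y^{1-t} + y^t z* x^{1-t} and F_t = y^{1-t} z* x^{2t-1} z y^{1-t} + x^{1-t} z y^{2t-1} z* x^{1-t}. Let T ∈ M_{2n}(ℂ) be the block matrix whose first block row is [x^{1/2}, y^{1/2}] and whose second block row is [y^{1-t} z* x^{(2t-1)/2}, x^{1-t} z y^{(2t-1)/2}]. Then the block matrix [[x+y, B_t], [B_t*, F_t]] equals T T*. -/

import Mathlib

open scoped Matrix ComplexOrder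

/-- The real power `A^s` of a positive semidefinite matrix, defined via the spectral
decomposition (equivalently, the continuous functional calculus), with the convention
`A^0 = 1`.  (If `A` is not Hermitian we return the junk value `0`.) -/
noncomputable def psdPow {N : ℕ} (A : Matrix (Fin N) (Fin N) ℂ) (s : ℝ) :
    Matrix (Fin N) (Fin N) ℂ :=
  if hA : A.IsHermitian then
    (Matrix.IsHermitian.eigenvectorUnitary hA : Matrix (Fin N) (Fin N) ℂ) *
      Matrix.diagonal (fun i => ((hA.eigenvalues i ^ s : ℝ) : ℂ)) *
      (Matrix.IsHermitian.eigenvectorUnitary hA : Matrix (Fin N) (Fin N) ℂ)ᴴ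
  else 0

theorem psdPow_conjTranspose {N : ℕ} (A : Matrix (Fin N) (Fin N) ℂ) (s : ℝ) :
    (psdPow A s)ᴴ = psdPow A s := by
  unfold psdPow
  split_ifs with hA
  · rw [Matrix.conjTranspose_mul, Matrix.conjTranspose_mul, Matrix.conjTranspose_conjTranspose,
      Matrix.diagonal_conjTranspose, Matrix.mul_assoc]
    congr 3
    ext i
    simp
  · simp

theorem psdPow_mul_psdPow {N : ℕ} {A : Matrix (Fin N) (Fin N) ℂ} (hA : A.PosSemidef)
    {r s : ℝ} (hr : 0 ≤ r) (hs : 0 ≤ s) :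
    psdPow A r * psdPow A s = psdPow A (r + s) := by
  have hU : (Matrix.IsHermitian.eigenvectorUnitary hA.1 : Matrix (Fin N) (Fin N) ℂ)ᴴ *
      (Matrix.IsHermitian.eigenvectorUnitary hA.1 : Matrix (Fin N) (Fin N) ℂ) = 1 :=
    Unitary.coe_star_mul_self _
  have hD : Matrix.diagonal (fun i => ((hA.1.eigenvalues i ^ r : ℝ) : ℂ)) *
      Matrix.diagonal (fun i => ((hA.1.eigenvalues i ^ s : ℝ) : ℂ)) =
      Matrix.diagonal (fun i => ((hA.1.eigenvalues i ^ (r + s) : ℝ) : ℂ)) := by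
    rw [Matrix.diagonal_mul_diagonal]
    congr 1
    ext i
    rw [Real.rpow_add_of_nonneg (hA.eigenvalues_nonneg i) hr hs, Complex.ofReal_mul]
  simp only [psdPow, dif_pos hA.1]
  rw [← hD]
  simp only [Matrix.mul_assoc]
  rw [← Matrix.mul_assoc _ᴴ, hU, Matrix.one_mul]

theorem psdPow_one {N : ℕ} {A : Matrix (Fin N) (Fin N) ℂ} (hA : A.IsHermitian) :
    psdPow A 1 = A := by
  simp only [psdPow, dif_pos hA, Real.rpow_one]
  exact hA.spectral_theorem.symm

theorem stmt5 {n : ℕ} (x y : Matrix (Fin n) (Fin n) ℂ)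
    (hx : x.PosSemidef) (hy : y.PosSemidef)
    (z : Matrix (Fin n) (Fin n) ℂ)
    (t : ℝ) (ht : t ∈ Set.Icc (1/2 : ℝ) 1) :
    Matrix.fromBlocks (x + y)
      (psdPow x t * z * psdPow y (1 - t) + psdPow y t * zᴴ * psdPow x (1 - t))
      (psdPow x t * z * psdPow y (1 - t) + psdPow y t * zᴴ * psdPow x (1 - t))ᴴ
      (psdPow y (1 - t) * zᴴ * psdPow x (2*t - 1) * z * psdPow y (1 - t) +
      psdPow x (1 - t) * z * psdPow y (2*t - 1) * zᴴ * psdPow x (1 - t)) =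
    (Matrix.fromBlocks (psdPow x (1/2)) (psdPow y (1/2))
        (psdPow y (1 - t) * zᴴ * psdPow x ((2*t - 1)/2))
        (psdPow x (1 - t) * z * psdPow y ((2*t - 1)/2))) *
      (Matrix.fromBlocks (psdPow x (1/2)) (psdPow y (1/2))
        (psdPow y (1 - t) * zᴴ * psdPow x ((2*t - 1)/2))
        (psdPow x (1 - t) * z * psdPow y ((2*t - 1)/2)))ᴴ := by
  have h0 : 0 ≤ (2 * t - 1) / 2 := by linarith [ht.1]
  have half : ∀ {A : Matrix (Fin n) (Fin n) ℂ}, A.PosSemidef →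
      psdPow A (1/2) * psdPow A (1/2) = A := fun hA => by
    rw [psdPow_mul_psdPow hA (by norm_num) (by norm_num), add_halves, psdPow_one hA.1]
  have left : ∀ {A : Matrix (Fin n) (Fin n) ℂ}, A.PosSemidef →
      psdPow A t = psdPow A (1/2) * psdPow A ((2 * t - 1) / 2) := fun hA => by
    rw [psdPow_mul_psdPow hA (by norm_num) h0]
    congr 1
    ring
  have mid : ∀ {A : Matrix (Fin n) (Fin n) ℂ}, A.PosSemidef →
      psdPow A (2 * t - 1) = psdPow A ((2 * t - 1) / 2) * psdPow A ((2 * t - 1) / 2) :=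
    fun hA => by rw [psdPow_mul_psdPow hA h0 h0, add_halves]
  rw [Matrix.fromBlocks_conjTranspose, Matrix.fromBlocks_multiply, left hx, left hy, mid hx, mid hy]
  simp only [Matrix.conjTranspose_mul, Matrix.conjTranspose_add, psdPow_conjTranspose,
    Matrix.conjTranspose_conjTranspose, half hx, half hy, Matrix.mul_assoc]
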